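/- arXiv:1302.6182 — 2 statements merged into one kernel-verified Lean document; each statement's English description precedes it below -/
import Mathlib

section
/- Let P be a Markov kernel on a measurable space (X, 𝒳) admitting the probability measure π as a stationary distribution. Suppose there exist n₀ ∈ ℕ⁺, ξ ∈ (0, 1], and a probability measure ν such that the n₀-step kernel satisfies Pⁿ⁰(x, A) ≥ ξ · ν(A) for every x ∈ X and every measurable A (i.e., the whole state space is a small set for P). Then P is uniformly ergodic: for every n ∈ ℕ, every x ∈ X, and every measurable set A, |Pⁿ(x, A) − π(A)| ≤ (1 − ξ)^⌊n/n₀⌋. In particular, there exist R < ∞ and ρ ∈ (0, 1) such that sup_A |Pⁿ(x, A) − π(A)| ≤ R ρⁿ for all x and n. -/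
open MeasureTheory ProbabilityTheory
open scoped ENNReal

/-- The `n`-step kernel `Pⁿ`, obtained by composing `P` with itself `n` times. -/
noncomputable def Kernel.iterate {X : Type*} [MeasurableSpace X]
    (P : ProbabilityTheory.Kernel X X) : ℕ → ProbabilityTheory.Kernel X X
  | 0 => ProbabilityTheory.Kernel.id
  | n + 1 => P ∘ₖ Kernel.iterate P n

lemma Kernel.iterate_add_aux {X : Type*} [MeasurableSpace X] (P : Kernel X X) (m n : ℕ) :
    Kernel.iterate P (m + n) = Kernel.iterate P m ∘ₖ Kernel.iterate P n := by
  induction m with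
  | zero => simp [Kernel.iterate, ProbabilityTheory.Kernel.id_comp]
  | succ m ih =>
    rw [Nat.succ_add]
    simp only [Kernel.iterate]
    rw [ih, ProbabilityTheory.Kernel.comp_assoc]

lemma Kernel.iterate_markov_aux {X : Type*} [MeasurableSpace X] (P : Kernel X X)
    (hP : IsMarkovKernel P) (n : ℕ) : IsMarkovKernel (Kernel.iterate P n) := by
  induction n with
  | zero => simp only [Kernel.iterate]; infer_instance
  | succ m ih => simp only [Kernel.iterate]; infer_instance

lemma stat_iterate_aux {X : Type*} [MeasurableSpace X] (P : Kernel X X)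
    (π : Measure X) (hstat : ∀ A : Set X, MeasurableSet A → ∫⁻ x, P x A ∂π = π A)
    (n : ℕ) : π.bind (Kernel.iterate P n) = π := by
  induction n with
  | zero => simp only [Kernel.iterate]; exact Measure.id_comp
  | succ m ih =>
    simp only [Kernel.iterate]
    rw [← Measure.comp_assoc, ih]
    ext A hA
    rw [Measure.bind_apply hA (ProbabilityTheory.Kernel.aemeasurable _), hstat A hA]

lemma contraction_aux {X : Type*} [MeasurableSpace X] [Nonempty X]
    (f : X → ℝ) (hf : Measurable f) (h0 : ∀ x, 0 ≤ f x) (h1 : ∀ x, f x ≤ 1)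
    (c : ℝ) (hc : ∀ x y, f x - f y ≤ c)
    (μ₁ μ₂ ν : Measure X) [IsProbabilityMeasure μ₁] [IsProbabilityMeasure μ₂]
    [IsProbabilityMeasure ν] (ξ : ℝ≥0∞)
    (k1 : ξ • ν ≤ μ₁) (k2 : ξ • ν ≤ μ₂) :
    ∫ x, f x ∂μ₁ - ∫ x, f x ∂μ₂ ≤ (1 - ξ.toReal) * c := by
  have hbd : BddBelow (Set.range f) := ⟨0, by rintro _ ⟨x, rfl⟩; exact h0 x⟩
  obtain ⟨m, hm1, hm2⟩ : ∃ m : ℝ, (∀ x, m ≤ f x) ∧ ∀ x, f x ≤ m + c := by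
    refine ⟨⨅ y, f y, fun x => ciInf_le hbd x, fun x => ?_⟩
    have : f x - c ≤ ⨅ y, f y := le_ciInf fun y => by linarith [hc x y]
    linarith
  have hi : ∀ (μ : Measure X) [IsProbabilityMeasure μ], Integrable f μ := fun μ _ =>
    Integrable.of_bound hf.aestronglyMeasurable 1
      (Filter.Eventually.of_forall fun x => by
        rw [Real.norm_eq_abs, abs_of_nonneg (h0 x)]; exact h1 x)
  have e1 := integral_mono_measure (f := fun x => m + c - f x) k1
    (Filter.Eventually.of_forall fun x => by simpa using hm2 x)
    ((integrable_const _).sub (hi μ₁))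
  have e2 := integral_mono_measure (f := fun x => f x - m) k2
    (Filter.Eventually.of_forall fun x => by simpa using hm1 x)
    ((hi μ₂).sub (integrable_const _))
  rw [integral_smul_measure, integral_sub (integrable_const _) (hi _),
    integral_sub (integrable_const _) (hi _)] at e1
  rw [integral_smul_measure, integral_sub (hi _) (integrable_const _),
    integral_sub (hi _) (integrable_const _)] at e2
  simp only [integral_const, probReal_univ, smul_eq_mul, one_mul] at e1 e2
  nlinarith

lemma osc_aux {X : Type*} [MeasurableSpace X]
    (P : Kernel X X) (hP : IsMarkovKernel P) (n₀ : ℕ)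
    (ξ : ℝ≥0∞) (ν : Measure X) (hν : IsProbabilityMeasure ν)
    (hmin : ∀ x : X, ∀ A : Set X, MeasurableSet A → ξ * ν A ≤ Kernel.iterate P n₀ x A)
    (r k : ℕ) (A : Set X) (hA : MeasurableSet A) (x y : X) :
    (Kernel.iterate P (r + k * n₀) x A).toReal - (Kernel.iterate P (r + k * n₀) y A).toReal
      ≤ (1 - ξ.toReal) ^ k := by
  have hM := Kernel.iterate_markov_aux P hP
  induction k generalizing x y with
  | zero =>
    have h1 : (Kernel.iterate P (r + 0 * n₀) x).real A ≤ 1 := measureReal_le_one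
    have h2 : 0 ≤ (Kernel.iterate P (r + 0 * n₀) y).real A := measureReal_nonneg
    simp only [Measure.real] at h1 h2
    simp only [pow_zero]
    linarith
  | succ k ih =>
    haveI : Nonempty X := ⟨x⟩
    have key : ∀ z, (Kernel.iterate P (r + (k + 1) * n₀) z A).toReal
        = ∫ w, (Kernel.iterate P (r + k * n₀) w A).toReal ∂(Kernel.iterate P n₀ z) := by
      intro z
      rw [show r + (k + 1) * n₀ = (r + k * n₀) + n₀ by ring, Kernel.iterate_add_aux,
        ProbabilityTheory.Kernel.comp_apply' _ _ _ hA, integral_toReal]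
      · exact (ProbabilityTheory.Kernel.measurable_coe _ hA).aemeasurable
      · exact Filter.Eventually.of_forall fun w => measure_lt_top _ _
    have hle : ∀ z, ξ • ν ≤ Kernel.iterate P n₀ z := fun z =>
      Measure.le_iff.2 fun s hs => by simpa using hmin z s hs
    rw [key x, key y, pow_succ']
    exact contraction_aux _ (ProbabilityTheory.Kernel.measurable_coe _ hA).ennreal_toReal
      (fun _ => ENNReal.toReal_nonneg) (fun w => measureReal_le_one) _ ih _ _ ν ξ (hle x) (hle y)

/-- **Uniform ergodicity from a whole-space minorization.**
If a Markov kernel `P` with stationary distribution `π` satisfies the whole-space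
minorization `Pⁿ⁰(x, A) ≥ ξ ν(A)` for some `n₀ ≥ 1`, `ξ ∈ (0, 1]` and probability
measure `ν`, then `P` is uniformly ergodic: `|Pⁿ(x, A) − π(A)| ≤ (1 − ξ)^⌊n/n₀⌋`
for all `n`, `x`, and measurable `A`; in particular there are `R < ∞` and `ρ ∈ (0, 1)`
with `sup_A |Pⁿ(x, A) − π(A)| ≤ R ρⁿ`. -/
theorem minorization_uniformly_ergodic
    {X : Type*} [MeasurableSpace X]
    (P : Kernel X X) (hP : IsMarkovKernel P)
    (π : Measure X) (hπ : IsProbabilityMeasure π)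
    (hstat : ∀ A : Set X, MeasurableSet A → ∫⁻ x, P x A ∂π = π A)
    (n₀ : ℕ) (hn₀ : 0 < n₀)
    (ξ : ℝ≥0∞) (hξ : 0 < ξ) (hξ1 : ξ ≤ 1)
    (ν : Measure X) (hν : IsProbabilityMeasure ν)
    (hmin : ∀ x : X, ∀ A : Set X, MeasurableSet A → ξ * ν A ≤ Kernel.iterate P n₀ x A) :
    (∀ n : ℕ, ∀ x : X, ∀ A : Set X, MeasurableSet A →
        |(Kernel.iterate P n x A).toReal - (π A).toReal| ≤ (1 - ξ.toReal) ^ (n / n₀)) ∧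
      ∃ R : ℝ, ∃ ρ : ℝ, ρ ∈ Set.Ioo (0 : ℝ) 1 ∧
        ∀ n : ℕ, ∀ x : X, ∀ A : Set X, MeasurableSet A →
          |(Kernel.iterate P n x A).toReal - (π A).toReal| ≤ R * ρ ^ n := by
  have hM := Kernel.iterate_markov_aux P hP
  have hξr : 0 < ξ.toReal := ENNReal.toReal_pos hξ.ne' (ne_top_of_le_ne_top ENNReal.one_ne_top hξ1)
  have hξr1 : ξ.toReal ≤ 1 := by
    simpa using ENNReal.toReal_mono ENNReal.one_ne_top hξ1
  have main : ∀ n : ℕ, ∀ x : X, ∀ A : Set X, MeasurableSet A →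
      |(Kernel.iterate P n x A).toReal - (π A).toReal| ≤ (1 - ξ.toReal) ^ (n / n₀) := by
    intro n x A hA
    have osc := osc_aux P hP n₀ ξ ν hν hmin (n % n₀) (n / n₀) A hA
    rw [Nat.mod_add_div'] at osc
    have hpi : (π A).toReal = ∫ y, (Kernel.iterate P n y A).toReal ∂π := by
      conv_lhs => rw [← stat_iterate_aux P π hstat n]
      rw [Measure.bind_apply hA (ProbabilityTheory.Kernel.aemeasurable _), integral_toReal]
      · exact (ProbabilityTheory.Kernel.measurable_coe _ hA).aemeasurable
      · exact Filter.Eventually.of_forall fun w => measure_lt_top _ _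
    have hi : Integrable (fun y => (Kernel.iterate P n y A).toReal) π :=
      Integrable.of_bound
        (ProbabilityTheory.Kernel.measurable_coe _ hA).ennreal_toReal.aestronglyMeasurable 1
        (Filter.Eventually.of_forall fun w => by
          rw [Real.norm_eq_abs, abs_of_nonneg ENNReal.toReal_nonneg]
          exact measureReal_le_one)
    have u1 := integral_mono hi (integrable_const
      ((Kernel.iterate P n x A).toReal + (1 - ξ.toReal) ^ (n / n₀)))
      (fun y => by linarith [osc y x])
    have u2 := integral_mono (integrable_const
      ((Kernel.iterate P n x A).toReal - (1 - ξ.toReal) ^ (n / n₀))) hi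
      (fun y => by linarith [osc x y])
    simp only [integral_const, probReal_univ, smul_eq_mul, one_mul] at u1 u2
    rw [hpi, abs_le]
    constructor <;> linarith
  refine ⟨main, ?_⟩
  obtain ⟨r, hr0, hr1, hr⟩ : ∃ r : ℝ, 0 < r ∧ r < 1 ∧ 1 - ξ.toReal ≤ r :=
    ⟨max (1 - ξ.toReal) (1 / 2), by positivity, max_lt (by linarith) (by norm_num),
      le_max_left _ _⟩
  have hρ0 : 0 < r ^ ((n₀ : ℝ)⁻¹) := Real.rpow_pos_of_pos hr0 _
  have hρ1 : r ^ ((n₀ : ℝ)⁻¹) < 1 :=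
    Real.rpow_lt_one hr0.le hr1 (by positivity)
  have hρn : (r ^ ((n₀ : ℝ)⁻¹)) ^ n₀ = r := Real.rpow_inv_natCast_pow hr0.le hn₀.ne'
  refine ⟨r⁻¹, r ^ ((n₀ : ℝ)⁻¹), ⟨hρ0, hρ1⟩, fun n x A hA => (main n x A hA).trans ?_⟩
  generalize r ^ ((n₀ : ℝ)⁻¹) = ρ at *
  calc (1 - ξ.toReal) ^ (n / n₀) ≤ r ^ (n / n₀) := pow_le_pow_left₀ (by linarith) hr _
    _ = r⁻¹ * ρ ^ (n₀ * (n / n₀ + 1)) := by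
      rw [pow_mul, hρn, pow_succ]; field_simp
    _ ≤ r⁻¹ * ρ ^ n := by
      refine mul_le_mul_of_nonneg_left ?_ (by positivity)
      exact pow_le_pow_of_le_one hρ0.le hρ1.le (Nat.lt_mul_div_succ n hn₀).le
end

section
/- Let P be a Markov kernel on a measurable space (X, 𝒳) and suppose there exist n₀ ∈ ℕ⁺, ξ ∈ (0, 1], and a probability measure ν such that Pⁿ⁰(x, A) ≥ ξ · ν(A) for every x ∈ X and every measurable A. Then P has at most one stationary probability distribution: if π and π' are both probability measures satisfying ∫ P(x, A) dπ(x) = π(A) and ∫ P(x, A) dπ'(x) = π'(A) for all measurable A, then π = π'. -/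
open MeasureTheory ProbabilityTheory
open scoped ENNReal

theorem iterate_isMarkov {X : Type*} [MeasurableSpace X]
    (P : Kernel X X) [IsMarkovKernel P] (n : ℕ) : IsMarkovKernel (Kernel.iterate P n) := by
  induction n with
  | zero => simp only [Kernel.iterate]; infer_instance
  | succ n ih => simp only [Kernel.iterate]; infer_instance

theorem iterate_stationary {X : Type*} [MeasurableSpace X]
    (P : Kernel X X) (μ : Measure X)
    (h : ∀ A : Set X, MeasurableSet A → ∫⁻ x, P x A ∂μ = μ A) (n : ℕ) :
    μ.bind (Kernel.iterate P n) = μ := by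
  have h1 : μ.bind P = μ := by
    ext A hA
    rw [Measure.bind_apply hA P.aemeasurable, h A hA]
  induction n with
  | zero => exact Measure.id_comp
  | succ n ih =>
    simp only [Kernel.iterate]
    rw [← Measure.comp_assoc, ih, h1]

theorem iterate_integral {X : Type*} [MeasurableSpace X]
    (Q : Kernel X X) [IsMarkovKernel Q] (μ : Measure X)
    (h : μ.bind Q = μ) (A : Set X) (hA : MeasurableSet A) :
    ∫ x, (Q x).real A ∂μ = μ.real A := by
  have : μ A = ∫⁻ x, Q x A ∂μ := by
    conv_lhs => rw [← h]
    exact Measure.bind_apply hA Q.aemeasurable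
  rw [Measure.real, this]
  exact integral_toReal (Q.measurable_coe hA).aemeasurable
    (Filter.Eventually.of_forall fun x => measure_lt_top _ _)

/-- **Uniqueness of the stationary distribution under a whole-space minorization.**
If a Markov kernel `P` satisfies `Pⁿ⁰(x, A) ≥ ξ ν(A)` for all `x` and measurable `A`,
with `n₀ ≥ 1`, `ξ ∈ (0, 1]`, and `ν` a probability measure, then `P` admits at most one
stationary probability distribution. -/
theorem minorization_unique_stationary
    {X : Type*} [MeasurableSpace X]
    (P : Kernel X X) (hP : IsMarkovKernel P)
    (n₀ : ℕ) (hn₀ : 0 < n₀)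
    (ξ : ℝ≥0∞) (hξ : 0 < ξ) (hξ1 : ξ ≤ 1)
    (ν : Measure X) (hν : IsProbabilityMeasure ν)
    (hmin : ∀ x : X, ∀ A : Set X, MeasurableSet A → ξ * ν A ≤ Kernel.iterate P n₀ x A)
    (π π' : Measure X) (hπ : IsProbabilityMeasure π) (hπ' : IsProbabilityMeasure π')
    (hstat : ∀ A : Set X, MeasurableSet A → ∫⁻ x, P x A ∂π = π A)
    (hstat' : ∀ A : Set X, MeasurableSet A → ∫⁻ x, P x A ∂π' = π' A) :
    π = π' := by
  have hQ := iterate_isMarkov P n₀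
  have e1 := iterate_stationary P π hstat n₀
  have e2 := iterate_stationary P π' hstat' n₀
  generalize Kernel.iterate P n₀ = Q at hmin hQ e1 e2
  obtain ⟨s, hs⟩ := exists_isHahnDecomposition π' π
  have ms := hs.measurableSet
  have i1 := iterate_integral Q π e1 s ms
  have i2 := iterate_integral Q π' e2 s ms
  have hξt : ξ ≠ ∞ := ne_top_of_le_ne_top ENNReal.one_ne_top hξ1
  have hr : 0 < ξ.toReal := ENNReal.toReal_pos hξ.ne' hξt
  have hmr : ∀ x A, MeasurableSet A → ξ.toReal * ν.real A ≤ (Q x).real A := by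
    intro x A hA
    have := ENNReal.toReal_mono (measure_ne_top _ _) (hmin x A hA)
    rwa [ENNReal.toReal_mul] at this
  set r := ξ.toReal
  set a := r * ν.real s
  set f : X → ℝ := fun x => (Q x).real s
  have fm : Measurable f := (Q.measurable_coe ms).ennreal_toReal
  have f0 : ∀ x, 0 ≤ f x - a := fun x => sub_nonneg.2 (hmr x s ms)
  have f1 : ∀ x, 0 ≤ (1 - r) - (f x - a) := by
    intro x
    have h1 := hmr x sᶜ ms.compl
    rw [probReal_compl_eq_one_sub ms, probReal_compl_eq_one_sub ms] at h1
    simp only [f, a]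
    linarith
  have fi : ∀ (μ : Measure X) [IsFiniteMeasure μ], Integrable f μ := by
    intro μ _
    refine Integrable.of_bound fm.aestronglyMeasurable 1 (Filter.Eventually.of_forall fun x => ?_)
    rw [Real.norm_of_nonneg measureReal_nonneg]
    exact measureReal_le_one
  have k1 := integral_mono_measure (f := fun x => (1 - r) - (f x - a)) hs.le_on
    (Filter.Eventually.of_forall f1)
    ((integrable_const _).sub ((fi _).sub (integrable_const _)))
  have k2 := integral_mono_measure (f := fun x => f x - a) hs.ge_on_compl
    (Filter.Eventually.of_forall f0) ((fi _).sub (integrable_const _))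
  have ex1 : ∀ (μ : Measure X) [IsFiniteMeasure μ],
      ∫ x, (f x - a) ∂μ = ∫ x, f x ∂μ - μ.real Set.univ * a := by
    intro μ _
    rw [integral_sub (fi μ) (integrable_const _)]; simp
  have ex2 : ∀ (μ : Measure X) [IsFiniteMeasure μ],
      ∫ x, ((1 - r) - (f x - a)) ∂μ
        = μ.real Set.univ * (1 - r) - (∫ x, f x ∂μ - μ.real Set.univ * a) := by
    intro μ _
    have hi : Integrable (fun x => f x - a) μ := (fi μ).sub (integrable_const _)
    rw [integral_sub (integrable_const _) hi, ex1]; simp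
  rw [ex1, ex1] at k2
  rw [ex2, ex2] at k1
  simp only [measureReal_restrict_apply_univ] at k1 k2
  have s1 := integral_add_compl ms (fi π)
  have s2 := integral_add_compl ms (fi π')
  rw [probReal_compl_eq_one_sub ms, probReal_compl_eq_one_sub ms] at k2
  have key : r * (π.real s - π'.real s) ≤ 0 := by nlinarith
  have l1 : π.real s ≤ π'.real s := by
    by_contra! hc
    nlinarith [mul_pos hr (sub_pos.2 hc)]
  have l2 : π' s ≤ π s := by simpa using hs.le_on Set.univ
  have l3 : π' s = π s := le_antisymm l2
    ((ENNReal.toReal_le_toReal (measure_ne_top _ _) (measure_ne_top _ _)).1 l1)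
  have q1 : π'.restrict s = π.restrict s :=
    Measure.eq_of_le_of_measure_univ_eq hs.le_on (by simpa using l3)
  have q2 : π.restrict sᶜ = π'.restrict sᶜ :=
    Measure.eq_of_le_of_measure_univ_eq hs.ge_on_compl
      (by simp [prob_compl_eq_one_sub ms, l3])
  rw [← Measure.restrict_add_restrict_compl (μ := π) ms, ← q1, q2,
    Measure.restrict_add_restrict_compl ms]
end
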